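/- arXiv:2206.08820 — 2 statements merged into one kernel-verified Lean document; each statement's English description precedes it below -/
import Mathlib

section
/- Under the standing assumptions on a and q, for every bounded set K ⊂ [0,∞) there exist constants C > 0 and b₀ > 0 such that for all c ∈ K, all real b with |b| ≥ b₀, and every smooth compactly supported function u : ℝ → ℂ, setting λ = −c + i·b, one has (‖u'‖² + ∫_ℝ q(x)|u(x)|² dx)^{1/2} ≤ C·‖T(λ)u‖. (This is the statement that ‖H_q^{1/2} T(λ)^{-1}‖ ≲_K 1, expressed on the core C_c^∞(ℝ).) -/
open MeasureTheory Filter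
open scoped ENNReal

/-- The quadratic operator family `T(λ)u = -u'' + q·u + 2λ·a·u + λ²·u`. -/
noncomputable def Tq (a q : ℝ → ℝ) (lam : ℂ) (u : ℝ → ℂ) : ℝ → ℂ :=
  fun x => -deriv (deriv u) x + (q x : ℂ) * u x + 2 * lam * (a x : ℂ) * u x + lam ^ 2 * u x

/-- Standing assumptions on the damping `a` and the potential `q`. -/
structure Standing (a q : ℝ → ℝ) : Prop where
  smooth_a : ContDiff ℝ (⊤ : ℕ∞) a
  smooth_q : ContDiff ℝ (⊤ : ℕ∞) q
  nonneg_a : ∀ x, 0 ≤ a x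
  nonneg_q : ∀ x, 0 ≤ q x
  unbounded_a : Tendsto a (cocompact ℝ) atTop
  deriv_a : ∀ n : ℕ, 1 ≤ n → ∃ C : ℝ, 0 < C ∧ ∀ x : ℝ,
      |iteratedDeriv n a x| ≤ C * (1 + a x) * (1 + x ^ 2) ^ (-(n : ℝ) / 2)
  deriv_q : ∀ n : ℕ, 1 ≤ n → ∃ C : ℝ, 0 < C ∧ ∀ x : ℝ,
      |iteratedDeriv n q x| ≤ C * (1 + q x) * (1 + x ^ 2) ^ (-(n : ℝ) / 2)
  q_le_a : ∃ K₀ : ℝ, 0 < K₀ ∧ ∃ x₀ : ℝ, 0 < x₀ ∧ ∀ x : ℝ, x₀ < |x| → q x ≤ K₀ * a x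

lemma int_comb3 (P R Z : ℝ → ℝ) (α β γ : ℝ) (hP : Integrable P) (hR : Integrable R)
    (hZ : Integrable Z) :
    ∫ x, (α * P x - β * R x - γ * Z x) = α * (∫ x, P x) - β * (∫ x, R x) - γ * ∫ x, Z x := by
  have h1 : Integrable (fun x => α * P x - β * R x) := (hP.const_mul _).sub (hR.const_mul _)
  rw [integral_sub h1 (hZ.const_mul _), integral_sub (hP.const_mul _) (hR.const_mul _),
    integral_const_mul, integral_const_mul, integral_const_mul]

lemma int_comb4 (R Q P Z : ℝ → ℝ) (β : ℝ) (hR : Integrable R) (hQ : Integrable Q)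
    (hP : Integrable P) (hZ : Integrable Z) :
    ∫ x, (R x + Q x - β * P x - Z x)
      = (∫ x, R x) + (∫ x, Q x) - β * (∫ x, P x) - ∫ x, Z x := by
  have h0 : Integrable (fun x => R x + Q x) := hR.add hQ
  have h1 : Integrable (fun x => R x + Q x - β * P x) := h0.sub (hP.const_mul _)
  rw [integral_sub h1 hZ, integral_sub h0 (hP.const_mul _), integral_add hR hQ,
    integral_const_mul]

lemma core_real (a q a1 q1 g g1 g2 ψ v w v1 w1 v2 w2 : ℝ → ℝ) (M δ ε b c : ℝ) (S : Set ℝ)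
    (hS : IsCompact S)
    (ha : ∀ x, HasDerivAt a (a1 x) x) (hq : ∀ x, HasDerivAt q (q1 x) x)
    (ha1 : Continuous a1) (hq1 : Continuous q1)
    (hg : ∀ x, HasDerivAt g (g1 x) x) (hg1 : ∀ x, HasDerivAt g1 (g2 x) x)
    (hg2 : Continuous g2)
    (hψ : ∀ x, HasDerivAt ψ (-2 * g x * (a x - c)) x)
    (hv : ∀ x, HasDerivAt v (v1 x) x) (hv1 : ∀ x, HasDerivAt v1 (v2 x) x) (hv2 : Continuous v2)
    (hw : ∀ x, HasDerivAt w (w1 x) x) (hw1 : ∀ x, HasDerivAt w1 (w2 x) x) (hw2 : Continuous w2)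
    (hvs : ∀ x, x ∉ S → v x = 0) (hws : ∀ x, x ∉ S → w x = 0)
    (hv1s : ∀ x, x ∉ S → v1 x = 0) (hw1s : ∀ x, x ∉ S → w1 x = 0)
    (hv2s : ∀ x, x ∉ S → v2 x = 0) (hw2s : ∀ x, x ∉ S → w2 x = 0)
    (hM : 0 < M) (hδ : 0 < δ) (hε : 0 < ε) (hεM : 11 * M * ε = δ)
    (bg : ∀ x, |g x| ≤ M) (bg1 : ∀ x, |g1 x| ≤ M) (bg2 : ∀ x, |g2 x| ≤ M) (bψ : ∀ x, |ψ x| ≤ M)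
    (bV : ∀ x, |2 * g1 x * (q x - 2 * c * a x + c ^ 2) + g x * (q1 x - 2 * c * a1 x)| ≤ M)
    (hpos : ∀ x, δ ≤ g1 x + 2 * (a x - c) * ψ x)
    (hq0 : ∀ x, 0 ≤ q x) (hc : 0 ≤ c) (hcb : c ≤ |b|) (hb1 : 1 ≤ |b|)
    (hb2 : M * (3 / 2 + 1 / (2 * ε)) ≤ δ / 2 * b ^ 2)
    (f1 f2 : ℝ → ℝ)
    (hf1 : f1 = fun x => - v2 x + (q x - 2 * c * a x + c ^ 2 - b ^ 2) * v x
      - 2 * b * (a x - c) * w x)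
    (hf2 : f2 = fun x => - w2 x + (q x - 2 * c * a x + c ^ 2 - b ^ 2) * w x
      + 2 * b * (a x - c) * v x) :
    (∫ x, (v1 x ^ 2 + w1 x ^ 2)) + (∫ x, q x * (v x ^ 2 + w x ^ 2))
      ≤ (3 * (M * (3 / 2 * ε + 2 / ε + 1 / 2)) / δ + 1) * ∫ x, (f1 x ^ 2 + f2 x ^ 2) := by
  have cont : ∀ {f f' : ℝ → ℝ}, (∀ x, HasDerivAt f (f' x) x) → Continuous f := fun h =>
    continuous_iff_continuousAt.2 fun x => (h x).continuousAt
  have ca := cont ha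
  have cq := cont hq
  have cg := cont hg
  have cg1 := cont hg1
  have cψ := cont hψ
  have cv := cont hv
  have cv1 := cont hv1
  have cw := cont hw
  have cw1 := cont hw1
  have cf1 : Continuous f1 := by rw [hf1]; fun_prop
  have cf2 : Continuous f2 := by rw [hf2]; fun_prop
  have hf1s : ∀ x, x ∉ S → f1 x = 0 := fun x hx => by
    simp [hf1, hvs x hx, hws x hx, hv2s x hx]
  have hf2s : ∀ x, x ∉ S → f2 x = 0 := fun x hx => by
    simp [hf2, hvs x hx, hws x hx, hw2s x hx]
  have integ : ∀ f : ℝ → ℝ, Continuous f → (∀ x, x ∉ S → f x = 0) → Integrable f := fun f hf h0 =>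
    hf.integrable_of_hasCompactSupport (HasCompactSupport.intro hS h0)
  have iP : Integrable (fun x => v x ^ 2 + w x ^ 2) := integ _ (by fun_prop) fun x hx => by
    simp [hvs x hx, hws x hx]
  have iR : Integrable (fun x => v1 x ^ 2 + w1 x ^ 2) := integ _ (by fun_prop) fun x hx => by
    simp [hv1s x hx, hw1s x hx]
  have iZ : Integrable (fun x => f1 x ^ 2 + f2 x ^ 2) := integ _ (by fun_prop) fun x hx => by
    simp [hf1s x hx, hf2s x hx]
  have iQ : Integrable (fun x => q x * (v x ^ 2 + w x ^ 2)) := integ _ (by fun_prop) fun x hx => by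
    simp [hvs x hx, hws x hx]
  -- second identity
  have e2 : ∫ x, ((v1 x ^ 2 + w1 x ^ 2) + q x * (v x ^ 2 + w x ^ 2)
      - (b ^ 2 + c ^ 2) * (v x ^ 2 + w x ^ 2) - (f1 x * v x + f2 x * w x)
      - c / b * (f2 x * v x - f1 x * w x)) = 0 := by
    apply integral_eq_zero_of_hasDerivAt_of_integrable
      (f := fun x => (v x * v1 x + w x * w1 x) + c / b * (w1 x * v x - v1 x * w x))
    · intro x
      have hb0 : b ≠ 0 := by
        intro h; simp [h] at hb1; linarith
      have := (((hv x).mul (hv1 x)).add ((hw x).mul (hw1 x))).add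
        ((((hw1 x).mul (hv x)).sub ((hv1 x).mul (hw x))).const_mul (c / b))
      refine this.congr_deriv ?_
      simp only [hf1, hf2]
      field_simp
      ring
    · exact integ _ (by fun_prop) fun x hx => by
        simp [hvs x hx, hws x hx, hv1s x hx, hw1s x hx]
    · exact integ _ (by fun_prop) fun x hx => by
        simp [hvs x hx, hws x hx, hv1s x hx, hw1s x hx]
  have hbb : 1 ≤ b ^ 2 := by rw [← sq_abs]; nlinarith
  have hcc : c ^ 2 ≤ b ^ 2 := by rw [← sq_abs b]; gcongr
  have hbne : 0 < |b| := by linarith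
  have i2 : (∫ x, (v1 x ^ 2 + w1 x ^ 2)) + (∫ x, q x * (v x ^ 2 + w x ^ 2))
      ≤ 3 * b ^ 2 * (∫ x, (v x ^ 2 + w x ^ 2)) + ∫ x, (f1 x ^ 2 + f2 x ^ 2) := by
    have key : ∫ x, ((v1 x ^ 2 + w1 x ^ 2) + q x * (v x ^ 2 + w x ^ 2)
        - 3 * b ^ 2 * (v x ^ 2 + w x ^ 2) - (f1 x ^ 2 + f2 x ^ 2)) ≤ 0 := by
      rw [← e2]
      apply integral_mono
      · exact ((iR.add iQ).sub (iP.const_mul _)).sub iZ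
      · exact integ _ (by fun_prop) fun x hx => by
          simp [hvs x hx, hws x hx, hv1s x hx, hw1s x hx]
      · intro x
        simp only
        have h1 : f1 x * v x + f2 x * w x ≤ ((v x ^ 2 + w x ^ 2) + (f1 x ^ 2 + f2 x ^ 2)) / 2 := by
          nlinarith [sq_nonneg (f1 x - v x), sq_nonneg (f2 x - w x)]
        have h2 : c / b * (f2 x * v x - f1 x * w x)
            ≤ ((v x ^ 2 + w x ^ 2) + (f1 x ^ 2 + f2 x ^ 2)) / 2 := by
          have h3 : |f2 x * v x - f1 x * w x|
            ≤ ((v x ^ 2 + w x ^ 2) + (f1 x ^ 2 + f2 x ^ 2)) / 2 := by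
            rw [abs_le]
            constructor <;> nlinarith [sq_nonneg (f1 x - w x), sq_nonneg (f2 x - v x),
              sq_nonneg (f1 x + w x), sq_nonneg (f2 x + v x)]
          have h4 : |c / b| ≤ 1 := by
            rw [abs_div, abs_of_nonneg hc]; exact (div_le_one hbne).2 hcb
          calc _ ≤ |c / b * (f2 x * v x - f1 x * w x)| := le_abs_self _
            _ = |c / b| * |f2 x * v x - f1 x * w x| := abs_mul _ _
            _ ≤ 1 * |f2 x * v x - f1 x * w x| := by gcongr
            _ ≤ _ := by linarith
        have h5 : (b ^ 2 + c ^ 2 + 1) * (v x ^ 2 + w x ^ 2) ≤ 3 * b ^ 2 * (v x ^ 2 + w x ^ 2) := by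
          gcongr; linarith
        linarith
    rw [int_comb4 _ _ _ _ _ iR iQ iP iZ] at key
    linarith
  -- first identity
  have e1 : ∫ x, (2 * b ^ 2 * (g1 x + 2 * (a x - c) * ψ x) * (v x ^ 2 + w x ^ 2)
      - (2 * g1 x * (q x - 2 * c * a x + c ^ 2) + g x * (q1 x - 2 * c * a1 x))
          * (v x ^ 2 + w x ^ 2)
      - g2 x * (v x * v1 x + w x * w1 x) - 2 * g x * (f1 x * v1 x + f2 x * w1 x)
      + g1 x * (f1 x * v x + f2 x * w x) + 2 * b * ψ x * (f1 x * w x - f2 x * v x)) = 0 := by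
    apply integral_eq_zero_of_hasDerivAt_of_integrable
      (f := fun x => g x * (v1 x * v1 x + w1 x * w1 x + (b ^ 2 - (q x - 2 * c * a x + c ^ 2))
          * (v x * v x + w x * w x))
        + 2 * b * (ψ x * (w1 x * v x - v1 x * w x)) - g1 x * (v x * v1 x + w x * w1 x))
    · intro x
      have h1 := ((hv x).mul (hv1 x)).add ((hw x).mul (hw1 x))
      have h2 := (((hw1 x).mul (hv x)).sub ((hv1 x).mul (hw x)))
      have h3 := ((hv x).mul (hv x)).add ((hw x).mul (hw x))
      have h4 := ((hv1 x).mul (hv1 x)).add ((hw1 x).mul (hw1 x))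
      have h5 := (((hq x).sub ((ha x).const_mul (2 * c))).add_const (c ^ 2)).const_sub (b ^ 2)
      have := (((hg x).mul (h4.add (h5.mul h3))).add (((hψ x).mul h2).const_mul (2 * b))).sub
        ((hg1 x).mul h1)
      refine this.congr_deriv ?_
      simp only [hf1, hf2, Pi.add_apply, Pi.mul_apply, Pi.sub_apply]
      ring
    · exact integ _ (by fun_prop) fun x hx => by
        simp [hvs x hx, hws x hx, hv1s x hx, hw1s x hx]
    · exact integ _ (by fun_prop) fun x hx => by
        simp [hvs x hx, hws x hx, hv1s x hx, hw1s x hx]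
  have i1 : (2 * δ * b ^ 2 - M * (3 / 2 + 1 / (2 * ε) + ε * b ^ 2)) * (∫ x, (v x ^ 2 + w x ^ 2))
      ≤ M * (3 / 2 * ε) * (∫ x, (v1 x ^ 2 + w1 x ^ 2))
        + M * (2 / ε + 1 / 2) * ∫ x, (f1 x ^ 2 + f2 x ^ 2) := by
    have key : ∫ x, ((2 * δ * b ^ 2 - M * (3 / 2 + 1 / (2 * ε) + ε * b ^ 2)) * (v x ^ 2 + w x ^ 2)
        - M * (3 / 2 * ε) * (v1 x ^ 2 + w1 x ^ 2)
        - M * (2 / ε + 1 / 2) * (f1 x ^ 2 + f2 x ^ 2)) ≤ 0 := by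
      rw [← e1]
      apply integral_mono
      · exact ((iP.const_mul _).sub (iR.const_mul _)).sub (iZ.const_mul _)
      · exact integ _ (by fun_prop) fun x hx => by
          simp [hvs x hx, hws x hx, hv1s x hx, hw1s x hx]
      · intro x
        simp only
        have dot : ∀ p r s t : ℝ, ∀ η : ℝ, 0 < η →
            |p * r + s * t| ≤ (1 / η * (p ^ 2 + s ^ 2) + η * (r ^ 2 + t ^ 2)) / 2 := by
          intro p r s t η hη
          have e : (1 / η * (p ^ 2 + s ^ 2) + η * (r ^ 2 + t ^ 2)) / 2
            = (p ^ 2 + s ^ 2 + η ^ 2 * (r ^ 2 + t ^ 2)) / (2 * η) := by field_simp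
          rw [e, le_div_iff₀ (by positivity), ← abs_of_pos (show 0 < 2 * η by positivity),
            ← abs_mul, abs_le]
          constructor <;> nlinarith [sq_nonneg (p - η * r), sq_nonneg (s - η * t),
            sq_nonneg (p + η * r), sq_nonneg (s + η * t)]
        have mulb : ∀ k z B : ℝ, |k| ≤ M → |z| ≤ B → |k * z| ≤ M * B := fun k z B hk hz => by
          rw [abs_mul]; exact mul_le_mul hk hz (abs_nonneg _) hM.le
        have t0 : 2 * b ^ 2 * δ * (v x ^ 2 + w x ^ 2)
            ≤ 2 * b ^ 2 * (g1 x + 2 * (a x - c) * ψ x) * (v x ^ 2 + w x ^ 2) := by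
          have := hpos x
          gcongr
        have t1 := (abs_le.1 (mulb _ _ _ (bV x)
          (abs_of_nonneg (show 0 ≤ v x ^ 2 + w x ^ 2 by positivity)).le)).2
        have t2 := (abs_le.1 (mulb _ _ _ (bg2 x) (dot (v x) (v1 x) (w x) (w1 x) ε hε))).2
        have t3 := (abs_le.1 (mulb _ _ _ (bg x) (dot (f1 x) (v1 x) (f2 x) (w1 x) ε hε))).2
        have t4 := (abs_le.1 (mulb _ _ _ (bg1 x) (dot (f1 x) (v x) (f2 x) (w x) 1 one_pos))).1
        have t5 := (abs_le.1 (mulb _ _ _ (bψ x)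
          (dot (f1 x) (b * w x) (f2 x) (-(b * v x)) ε hε))).1
        have e : 1 / (2 * ε) = (1 / ε) / 2 := by field_simp
        have e' : 2 / ε = 2 * (1 / ε) := by field_simp
        rw [e, e']
        generalize 1 / ε = ι at *
        generalize g1 x + 2 * (a x - c) * ψ x = G at *
        generalize 2 * g1 x * (q x - 2 * c * a x + c ^ 2) + g x * (q1 x - 2 * c * a1 x) = H at *
        linarith
    rw [int_comb3 _ _ _ _ _ _ iP iR iZ] at key
    linarith
  have x0 : 0 ≤ ∫ x, (v x ^ 2 + w x ^ 2) := integral_nonneg fun x => by positivity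
  have q0 : 0 ≤ ∫ x, q x * (v x ^ 2 + w x ^ 2) := integral_nonneg fun x =>
    mul_nonneg (hq0 x) (by positivity)
  generalize (∫ x, (v x ^ 2 + w x ^ 2)) = X at *
  generalize (∫ x, (v1 x ^ 2 + w1 x ^ 2)) = Y at *
  generalize (∫ x, q x * (v x ^ 2 + w x ^ 2)) = Q at *
  generalize (∫ x, (f1 x ^ 2 + f2 x ^ 2)) = Z at *
  have hY : M * (3 / 2 * ε) * Y ≤ M * (3 / 2 * ε) * (3 * b ^ 2 * X + Z) := by
    gcongr; linarith
  have h6 : M * (3 / 2 + 1 / (2 * ε)) * X ≤ δ / 2 * b ^ 2 * X := by gcongr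
  have h7 : δ * (b ^ 2 * X) ≤ (M * (3 / 2 * ε + 2 / ε + 1 / 2)) * Z := by
    have h8 : 11 * M * ε * (b ^ 2 * X) = δ * (b ^ 2 * X) := by rw [hεM]
    linarith
  have h9 : b ^ 2 * X ≤ (M * (3 / 2 * ε + 2 / ε + 1 / 2)) * Z / δ := by
    rw [le_div_iff₀ hδ]; linarith
  calc Y + Q ≤ 3 * (b ^ 2 * X) + Z := by linarith
    _ ≤ 3 * ((M * (3 / 2 * ε + 2 / ε + 1 / 2)) * Z / δ) + Z := by linarith
    _ = _ := by ring

lemma exists_escape (a : ℝ → ℝ) (hat : Tendsto a (cocompact ℝ) atTop) (ha0 : ∀ x, 0 ≤ a x)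
    (c₀ : ℝ) (hc₀ : 0 ≤ c₀) :
    ∃ t t1 t2 : ℝ → ℝ, ∃ S : Set ℝ, ∃ δ : ℝ, IsCompact S ∧ 0 < δ ∧
      (∀ x, HasDerivAt t (t1 x) x) ∧ (∀ x, HasDerivAt t1 (t2 x) x) ∧ Continuous t2 ∧
      (∀ x, x ∉ S → t x = 0 ∧ t1 x = 0 ∧ t2 x = 0) ∧ (∀ x, t x ^ 2 ≤ 1) ∧
      (∀ x, δ ≤ t1 x + 2 * (a x - c₀) * (1 - t x ^ 2)) := by
  let η : ContDiffBump (0 : ℝ) := ⟨1, 2, by norm_num, by norm_num⟩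
  let k : ℝ → ℝ := fun y => y * η y
  have hk : ContDiff ℝ (⊤ : ℕ∞) k := contDiff_id.mul η.contDiff
  have hkc : HasCompactSupport k := η.hasCompactSupport.mul_left
  have hk1 : ∀ y, |y| < 1 → deriv k y = 1 := by
    intro y hy
    have : k =ᶠ[nhds y] id := by
      filter_upwards [(isOpen_lt continuous_abs continuous_const).mem_nhds hy] with z hz
      have : η z = 1 := η.one_of_mem_closedBall (by
        simpa [Real.norm_eq_abs] using (le_of_lt hz))
      simp [k, this]
    rw [this.deriv_eq]; simp
  obtain ⟨D, hD⟩ := hkc.deriv.exists_bound_of_continuous (hk.continuous_deriv (by norm_num))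
  have hD0 : 0 ≤ D := (norm_nonneg _).trans (hD 0)
  obtain ⟨L, hL⟩ : ∃ L, L = 2 * c₀ + 1 := ⟨_, rfl⟩
  have hLpos : 0 < L := by linarith
  have hev := hat.eventually_ge_atTop (c₀ + L * D + 1)
  obtain ⟨N, hN0, hN⟩ : ∃ N : ℝ, 0 < N ∧ ∀ x, N ≤ |x| → c₀ + L * D + 1 ≤ a x := by
    obtain ⟨r, hr⟩ := (Metric.closedBall_compl_subset_of_mem_cocompact hev (0 : ℝ))
    refine ⟨|r| + 1, by positivity, fun x hx => hr ?_⟩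
    simp only [Set.mem_compl_iff, Metric.mem_closedBall, dist_zero_right, Real.norm_eq_abs, not_le]
    linarith [le_abs_self r]
  let s : ℝ → ℝ := fun x => L * N * k (x / N)
  have hs : ContDiff ℝ (⊤ : ℕ∞) s := contDiff_const.mul (hk.comp (contDiff_id.div_const N))
  have hs1 : ∀ x, HasDerivAt s (L * deriv k (x / N)) x := by
    intro x
    have h1 : HasDerivAt k (deriv k (x / N)) (x / N) :=
      (hk.differentiable (by norm_num) _).hasDerivAt
    have h2 := (h1.comp x ((hasDerivAt_id x).div_const N)).const_mul (L * N)
    refine h2.congr_deriv ?_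
    field_simp
  have hsc : HasCompactSupport s := by
    refine HasCompactSupport.intro (isCompact_closedBall (0 : ℝ) (2 * N)) fun x hx => ?_
    have hx' : 2 * N < |x| := by simpa using hx
    have : η (x / N) = 0 := by
      apply η.zero_of_le_dist
      rw [dist_zero_right, Real.norm_eq_abs, abs_div, abs_of_pos hN0, le_div_iff₀ hN0]
      exact hx'.le
    simp [s, k, this]
  let t : ℝ → ℝ := fun x => Real.tanh (s x)
  have ht : ContDiff ℝ (⊤ : ℕ∞) t := by
    have : t = fun x => Real.sinh (s x) / Real.cosh (s x) := by
      ext x; exact Real.tanh_eq_sinh_div_cosh _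
    rw [this]
    exact (Real.contDiff_sinh.comp hs).div (Real.contDiff_cosh.comp hs)
      fun x => (Real.cosh_pos _).ne'
  have htc : HasCompactSupport t := hsc.comp_left (g := Real.tanh) Real.tanh_zero
  have ht1 : ∀ x, HasDerivAt t ((1 - t x ^ 2) * (L * deriv k (x / N))) x := by
    intro x
    have e : t = fun x => Real.sinh (s x) / Real.cosh (s x) := by
      ext x; exact Real.tanh_eq_sinh_div_cosh _
    have h1 := (hs1 x).sinh.div (hs1 x).cosh (Real.cosh_pos _).ne'
    rw [e]
    refine h1.congr_deriv ?_
    have := (Real.cosh_pos (s x)).ne'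
    field_simp
  have htd : ContDiff ℝ (⊤ : ℕ∞) (deriv t) := ((contDiff_infty_iff_deriv).1 ht).2
  have hlt : ∀ x, t x ^ 2 < 1 := fun x => Real.tanh_sq_lt_one _
  obtain ⟨B, hB⟩ : ∃ B, ∀ x, ‖(fun y => (1 - t y ^ 2)⁻¹ - 1) x‖ ≤ B := by
    apply HasCompactSupport.exists_bound_of_continuous
    · exact htc.comp_left (g := fun z : ℝ => (1 - z ^ 2)⁻¹ - 1) (by simp)
    · have := ht.continuous
      refine Continuous.sub (Continuous.inv₀ (by fun_prop) fun x => ?_) continuous_const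
      have := hlt x
      linarith
  have hB0 : 0 ≤ B := (norm_nonneg _).trans (hB 0)
  refine ⟨t, deriv t, deriv (deriv t), tsupport t, (1 + B)⁻¹, htc, by positivity,
    fun x => (ht.differentiable (by norm_num) x).hasDerivAt,
    fun x => (htd.differentiable (by norm_num) x).hasDerivAt,
    htd.continuous_deriv (by norm_num), fun x hx => ⟨image_eq_zero_of_notMem_tsupport hx, ?_, ?_⟩,
    fun x => (hlt x).le, fun x => ?_⟩
  · exact image_eq_zero_of_notMem_tsupport fun h => hx (tsupport_deriv_subset h)
  · exact image_eq_zero_of_notMem_tsupport fun h =>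
      hx (tsupport_deriv_subset (tsupport_deriv_subset h))
  · rw [(ht1 x).deriv]
    have hp : 0 < 1 - t x ^ 2 := by linarith [hlt x]
    have h1 : (1 + B)⁻¹ ≤ 1 - t x ^ 2 := by
      apply inv_le_of_inv_le₀ hp
      have := (abs_le.1 (hB x)).2
      simp only at this
      linarith
    have h2 : 1 ≤ L * deriv k (x / N) + 2 * (a x - c₀) := by
      rcases lt_or_ge |x| N with hx | hx
      · rw [hk1 _ (by rw [abs_div, abs_of_pos hN0]; exact (div_lt_one hN0).2 hx)]
        linarith [ha0 x]
      · have h3 := hN x hx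
        have h4 := (abs_le.1 (hD (x / N))).1
        nlinarith [mul_le_mul_of_nonneg_left h4 hLpos.le, mul_nonneg hLpos.le hD0]
    nlinarith

lemma bound_param (Φ : ℝ → ℝ → ℝ) (hΦ : Continuous fun p : ℝ × ℝ => Φ p.1 p.2) (S : Set ℝ)
    (hS : IsCompact S) (h0 : ∀ c x, x ∉ S → Φ c x = 0) (c₀ : ℝ) :
    ∃ M : ℝ, 0 < M ∧ ∀ c ∈ Set.Icc 0 c₀, ∀ x, |Φ c x| ≤ M := by
  obtain ⟨C, hC⟩ := (isCompact_Icc (a := (0:ℝ)) (b := c₀)).prod hS |>.exists_bound_of_continuousOn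
    hΦ.continuousOn
  refine ⟨|C| + 1, by positivity, fun c hc x => ?_⟩
  by_cases hx : x ∈ S
  · have := hC (c, x) ⟨hc, hx⟩
    simp only [Real.norm_eq_abs] at this
    linarith [le_abs_self C]
  · rw [h0 c x hx]; simp; positivity

lemma exists_weights (a q a1 q1 : ℝ → ℝ) (hat : Tendsto a (cocompact ℝ) atTop)
    (ha0 : ∀ x, 0 ≤ a x) (ha : ∀ x, HasDerivAt a (a1 x) x) (ha1 : Continuous a1)
    (hq : Continuous q) (hq1 : Continuous q1) (c₀ : ℝ) (hc₀ : 0 ≤ c₀) :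
    ∃ M δ : ℝ, 0 < M ∧ 0 < δ ∧ ∀ c ∈ Set.Icc 0 c₀, ∃ g g1 g2 ψ : ℝ → ℝ,
      (∀ x, HasDerivAt g (g1 x) x) ∧ (∀ x, HasDerivAt g1 (g2 x) x) ∧ Continuous g2 ∧
      (∀ x, HasDerivAt ψ (-2 * g x * (a x - c)) x) ∧
      (∀ x, |g x| ≤ M) ∧ (∀ x, |g1 x| ≤ M) ∧ (∀ x, |g2 x| ≤ M) ∧ (∀ x, |ψ x| ≤ M) ∧
      (∀ x, |2 * g1 x * (q x - 2 * c * a x + c ^ 2) + g x * (q1 x - 2 * c * a1 x)| ≤ M) ∧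
      (∀ x, δ ≤ g1 x + 2 * (a x - c) * ψ x) := by
  obtain ⟨t, t1, t2, S, δ, hS, hδ, ht, ht1, ct2, hts, ht_le, hpos⟩ :=
    exists_escape a hat ha0 c₀ hc₀
  have cont : ∀ {f f' : ℝ → ℝ}, (∀ x, HasDerivAt f (f' x) x) → Continuous f := fun h =>
    continuous_iff_continuousAt.2 fun x => (h x).continuousAt
  have ca := cont ha
  have ct := cont ht
  have ct1 := cont ht1
  obtain ⟨M1, hM1, b1⟩ := bound_param (fun c x => t1 x - 2 * (a x - c) * t x ^ 2) (by fun_prop) S hS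
    (fun c x hx => by simp [hts x hx]) c₀
  obtain ⟨M2, hM2, b2⟩ := bound_param (fun c x => t2 x - 2 * a1 x * t x ^ 2
      - 4 * (a x - c) * t x * t1 x + (t1 x - 2 * (a x - c) * t x ^ 2) * (-2 * (a x - c) * t x))
    (by fun_prop) S hS (fun c x hx => by simp [hts x hx]) c₀
  obtain ⟨M3, hM3, b3⟩ := bound_param (fun c x => 2 * (t1 x - 2 * (a x - c) * t x ^ 2)
      * (q x - 2 * c * a x + c ^ 2) + t x * (q1 x - 2 * c * a1 x))
    (by fun_prop) S hS (fun c x hx => by simp [hts x hx]) c₀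
  have iI : Integrable (fun x => 2 * (a x + c₀) * |t x|) :=
    Continuous.integrable_of_hasCompactSupport (by fun_prop)
      (HasCompactSupport.intro hS fun x hx => by simp [hts x hx])
  obtain ⟨I, hI⟩ : ∃ I, I = ∫ x, 2 * (a x + c₀) * |t x| := ⟨_, rfl⟩
  refine ⟨(1 + M1 + M2 + M3) * Real.exp I, δ * Real.exp (-I), by positivity, by positivity, ?_⟩
  intro c hc
  let p : ℝ → ℝ := fun x => -2 * (a x - c) * t x
  have cp : Continuous p := by fun_prop
  let ψ : ℝ → ℝ := fun x => Real.exp (∫ y in (0:ℝ)..x, p y)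
  have hψ : ∀ x, HasDerivAt ψ (ψ x * p x) x := fun x =>
    (intervalIntegral.integral_hasDerivAt_right (cp.intervalIntegrable _ _)
      (cp.stronglyMeasurableAtFilter _ _) cp.continuousAt).exp
  have cψ := cont hψ
  have hbd : ∀ x, |∫ y in (0:ℝ)..x, p y| ≤ I := by
    intro x
    have ip : Integrable p := cp.integrable_of_hasCompactSupport
      (HasCompactSupport.intro hS fun x hx => by simp [p, hts x hx])
    rw [← Real.norm_eq_abs]
    calc ‖∫ y in (0:ℝ)..x, p y‖ ≤ ∫ y in Set.uIoc 0 x, ‖p y‖ :=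
          intervalIntegral.norm_integral_le_integral_norm_uIoc
      _ ≤ ∫ y, ‖p y‖ := setIntegral_le_integral ip.norm (Eventually.of_forall fun y => norm_nonneg _)
      _ ≤ I := by
        rw [hI]
        apply integral_mono ip.norm iI
        intro y
        simp only [p, Real.norm_eq_abs, abs_mul]
        have : |a y - c| ≤ a y + c₀ := by
          rw [abs_le]; constructor <;> linarith [ha0 y, hc.1, hc.2]
        norm_num
        gcongr
  have ψpos : ∀ x, 0 < ψ x := fun x => Real.exp_pos _
  have ψle : ∀ x, ψ x ≤ Real.exp I := fun x => Real.exp_le_exp.2 (abs_le.1 (hbd x)).2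
  have ψge : ∀ x, Real.exp (-I) ≤ ψ x := fun x => Real.exp_le_exp.2 (abs_le.1 (hbd x)).1
  have bnd : ∀ z x : ℝ, |z| ≤ 1 + M1 + M2 + M3 → |z * ψ x| ≤ (1 + M1 + M2 + M3) * Real.exp I := by
    intro z x hz
    rw [abs_mul, abs_of_pos (ψpos x)]
    exact mul_le_mul hz (ψle x) (ψpos x).le (by positivity)
  refine ⟨fun x => t x * ψ x, fun x => (t1 x - 2 * (a x - c) * t x ^ 2) * ψ x,
    fun x => (t2 x - 2 * a1 x * t x ^ 2
      - 4 * (a x - c) * t x * t1 x + (t1 x - 2 * (a x - c) * t x ^ 2) * (-2 * (a x - c) * t x)) * ψ x,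
    ψ, ?_, ?_, by fun_prop, ?_, ?_, ?_, ?_, ?_, ?_, ?_⟩
  · intro x
    refine ((ht x).mul (hψ x)).congr_deriv ?_
    simp only [p]; ring
  · intro x
    have h1 := (ht1 x).sub ((((ha x).sub_const c).const_mul 2).mul ((ht x).pow 2))
    refine (h1.mul (hψ x)).congr_deriv ?_
    simp only [p, Pi.sub_apply, Pi.mul_apply, Pi.pow_apply]
    push_cast
    ring
  · intro x
    refine (hψ x).congr_deriv ?_
    simp only [p]; ring
  · intro x
    refine bnd _ _ ?_
    have := (sq_le_one_iff_abs_le_one _).1 (ht_le x)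
    linarith
  · intro x
    refine bnd _ _ ?_
    have := b1 c hc x
    linarith
  · intro x
    refine bnd _ _ ?_
    have := b2 c hc x
    linarith
  · intro x
    have := bnd 1 x (by rw [abs_one]; linarith)
    rwa [one_mul] at this
  · intro x
    have := bnd _ x ((b3 c hc x).trans (by linarith))
    convert this using 2
    ring
  · intro x
    have h1 : δ ≤ t1 x + 2 * (a x - c) * (1 - t x ^ 2) := by
      nlinarith [hpos x, ht_le x, hc.2]
    calc δ * Real.exp (-I) ≤ (t1 x + 2 * (a x - c) * (1 - t x ^ 2)) * ψ x :=
          mul_le_mul h1 (ψge x) (Real.exp_pos _).le (hδ.le.trans h1)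
      _ = _ := by ring

lemma eLpNorm_two_sq (f : ℝ → ℂ) (hf : Integrable (fun x => (f x).re ^ 2 + (f x).im ^ 2)) :
    eLpNorm f 2 volume ^ 2 = ENNReal.ofReal (∫ x, ((f x).re ^ 2 + (f x).im ^ 2)) := by
  have h := eLpNorm_nnreal_pow_eq_lintegral (f := f) (μ := volume) (p := 2) (by norm_num)
  rw [ofReal_integral_eq_lintegral_ofReal hf (Eventually.of_forall fun x => by positivity)]
  have h' : eLpNorm f 2 volume ^ 2 = ∫⁻ x, ‖f x‖ₑ ^ 2 := by
    simpa using h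
  rw [h']
  refine lintegral_congr fun x => ?_
  rw [← ofReal_norm_eq_enorm, ← ENNReal.ofReal_pow (norm_nonneg _), Complex.sq_norm,
    Complex.normSq_apply]
  congr 1; ring

theorem stmt12 (a q : ℝ → ℝ) (h : Standing a q)
    (K : Set ℝ) (hKb : Bornology.IsBounded K) (hK : K ⊆ Set.Ici 0) :
    ∃ C : ℝ, 0 < C ∧ ∃ b₀ : ℝ, 0 < b₀ ∧ ∀ c ∈ K, ∀ b : ℝ, b₀ ≤ |b| →
      ∀ u : ℝ → ℂ, ContDiff ℝ (⊤ : ℕ∞) u → HasCompactSupport u →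
        (eLpNorm (deriv u) 2 volume ^ 2
            + ∫⁻ x : ℝ, ENNReal.ofReal (q x * ‖u x‖ ^ 2)) ^ ((1 : ℝ) / 2)
          ≤ ENNReal.ofReal C *
              eLpNorm (Tq a q (-(c : ℂ) + Complex.I * (b : ℂ)) u) 2 volume := by
  obtain ⟨c₀, hc₀, hKc⟩ : ∃ c₀ : ℝ, 0 ≤ c₀ ∧ ∀ c ∈ K, c ∈ Set.Icc 0 c₀ := by
    obtain ⟨r, hr⟩ := hKb.subset_closedBall (0 : ℝ)
    refine ⟨|r|, abs_nonneg r, fun c hc => ⟨hK hc, ?_⟩⟩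
    have h1 : |c| ≤ r := by simpa using hr hc
    exact (le_abs_self c).trans (h1.trans (le_abs_self r))
  have hda : ∀ x, HasDerivAt a (deriv a x) x := fun x =>
    (h.smooth_a.differentiable (by norm_num) x).hasDerivAt
  have hdq : ∀ x, HasDerivAt q (deriv q x) x := fun x =>
    (h.smooth_q.differentiable (by norm_num) x).hasDerivAt
  have ca1 : Continuous (deriv a) := h.smooth_a.continuous_deriv (by norm_num)
  have cq1 : Continuous (deriv q) := h.smooth_q.continuous_deriv (by norm_num)
  have ca := h.smooth_a.continuous
  have cq := h.smooth_q.continuous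
  obtain ⟨M, δ, hM, hδ, hW⟩ := exists_weights a q (deriv a) (deriv q) h.unbounded_a h.nonneg_a hda
    ca1 cq cq1 c₀ hc₀
  obtain ⟨ε, hε⟩ : ∃ ε, ε = δ / (11 * M) := ⟨_, rfl⟩
  have hε0 : 0 < ε := by rw [hε]; positivity
  have hεM : 11 * M * ε = δ := by rw [hε]; field_simp
  obtain ⟨D, hD⟩ : ∃ D, D = 3 * (M * (3 / 2 * ε + 2 / ε + 1 / 2)) / δ + 1 := ⟨_, rfl⟩
  have hD0 : 0 < D := by rw [hD]; positivity
  obtain ⟨B, hB⟩ : ∃ B, B = M * (3 / 2 + 1 / (2 * ε)) / (δ / 2) := ⟨_, rfl⟩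
  have hB0 : 0 < B := by rw [hB]; positivity
  refine ⟨Real.sqrt D, Real.sqrt_pos.2 hD0, 1 + c₀ + B, by positivity, ?_⟩
  intro c hc b hb u hu huc
  obtain ⟨g, g1, g2, ψ, hg, hg1, cg2, hψ, bg, bg1, bg2, bψ, bV, hpos⟩ := hW c (hKc c hc)
  have hcc := hKc c hc
  have hb1 : 1 ≤ |b| := by linarith
  have hb2 : M * (3 / 2 + 1 / (2 * ε)) ≤ δ / 2 * b ^ 2 := by
    have h1 : B ≤ b ^ 2 := by rw [← sq_abs]; nlinarith
    rw [hB, div_le_iff₀ (by positivity)] at h1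
    linarith
  have hu1 : ContDiff ℝ (⊤ : ℕ∞) (deriv u) := ((contDiff_infty_iff_deriv).1 hu).2
  have cu2 : Continuous (deriv (deriv u)) := hu1.continuous_deriv (by norm_num)
  have du : ∀ x, HasDerivAt u (deriv u x) x := fun x =>
    (hu.differentiable (by norm_num) x).hasDerivAt
  have du1 : ∀ x, HasDerivAt (deriv u) (deriv (deriv u) x) x := fun x =>
    (hu1.differentiable (by norm_num) x).hasDerivAt
  have hre : ∀ {f f' : ℝ → ℂ}, (∀ x, HasDerivAt f (f' x) x) →
      ∀ x, HasDerivAt (fun y => (f y).re) (f' x).re x := fun hf x =>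
    Complex.reCLM.hasFDerivAt.comp_hasDerivAt x (hf x)
  have him : ∀ {f f' : ℝ → ℂ}, (∀ x, HasDerivAt f (f' x) x) →
      ∀ x, HasDerivAt (fun y => (f y).im) (f' x).im x := fun hf x =>
    Complex.imCLM.hasFDerivAt.comp_hasDerivAt x (hf x)
  have s0 : ∀ x, x ∉ tsupport u → u x = 0 := fun x hx => image_eq_zero_of_notMem_tsupport hx
  have s1 : ∀ x, x ∉ tsupport u → deriv u x = 0 := fun x hx =>
    image_eq_zero_of_notMem_tsupport fun h => hx (tsupport_deriv_subset h)
  have s2 : ∀ x, x ∉ tsupport u → deriv (deriv u) x = 0 := fun x hx =>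
    image_eq_zero_of_notMem_tsupport fun h =>
      hx (tsupport_deriv_subset (tsupport_deriv_subset h))
  obtain ⟨f, hf⟩ : ∃ f, f = Tq a q (-(c : ℂ) + Complex.I * (b : ℂ)) u := ⟨_, rfl⟩
  have cu := hu.continuous
  have cu1 := hu1.continuous
  have cf : Continuous f := by
    rw [hf]; unfold Tq
    fun_prop
  have fs : ∀ x, x ∉ tsupport u → f x = 0 := fun x hx => by
    simp [hf, Tq, s0 x hx, s2 x hx]
  have key := core_real a q (deriv a) (deriv q) g g1 g2 ψ (fun x => (u x).re) (fun x => (u x).im)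
    (fun x => (deriv u x).re) (fun x => (deriv u x).im)
    (fun x => (deriv (deriv u) x).re) (fun x => (deriv (deriv u) x).im)
    M δ ε b c (tsupport u) huc hda hdq ca1 cq1 hg hg1 cg2 hψ
    (hre du) (hre du1) (Complex.continuous_re.comp cu2)
    (him du) (him du1) (Complex.continuous_im.comp cu2)
    (fun x hx => by simp [s0 x hx]) (fun x hx => by simp [s0 x hx])
    (fun x hx => by simp [s1 x hx]) (fun x hx => by simp [s1 x hx])
    (fun x hx => by simp [s2 x hx]) (fun x hx => by simp [s2 x hx])
    hM hδ hε0 hεM bg bg1 bg2 bψ bV hpos h.nonneg_q hcc.1 (by linarith [hcc.2]) hb1 hb2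
    (fun x => (f x).re) (fun x => (f x).im)
    (by
      ext x
      simp [hf, Tq, pow_two]
      ring)
    (by
      ext x
      simp [hf, Tq, pow_two]
      ring)
  rw [← hD] at key
  have integ : ∀ F : ℝ → ℝ, Continuous F → (∀ x, x ∉ tsupport u → F x = 0) → Integrable F :=
    fun F hF h0 => hF.integrable_of_hasCompactSupport (HasCompactSupport.intro huc h0)
  have i1 : Integrable (fun x => (deriv u x).re ^ 2 + (deriv u x).im ^ 2) :=
    integ _ (by fun_prop) fun x hx => by simp [s1 x hx]
  have i2 : Integrable (fun x => (f x).re ^ 2 + (f x).im ^ 2) :=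
    integ _ (by fun_prop) fun x hx => by simp [fs x hx]
  have i3 : Integrable (fun x => q x * ((u x).re ^ 2 + (u x).im ^ 2)) :=
    integ _ (by fun_prop) fun x hx => by simp [s0 x hx]
  rw [← hf]
  have hQ : ∫⁻ x : ℝ, ENNReal.ofReal (q x * ‖u x‖ ^ 2)
      = ENNReal.ofReal (∫ x, q x * ((u x).re ^ 2 + (u x).im ^ 2)) := by
    rw [ofReal_integral_eq_lintegral_ofReal i3
      (Eventually.of_forall fun x => mul_nonneg (h.nonneg_q x) (by positivity))]
    refine lintegral_congr fun x => ?_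
    rw [Complex.sq_norm, Complex.normSq_apply]
    congr 2; ring
  have main : eLpNorm (deriv u) 2 volume ^ 2 + ∫⁻ x : ℝ, ENNReal.ofReal (q x * ‖u x‖ ^ 2)
      ≤ (ENNReal.ofReal (Real.sqrt D) * eLpNorm f 2 volume) ^ 2 := by
    rw [mul_pow, eLpNorm_two_sq _ i1, eLpNorm_two_sq _ i2, hQ,
      ← ENNReal.ofReal_add (integral_nonneg fun x => by positivity)
        (integral_nonneg fun x => mul_nonneg (h.nonneg_q x) (by positivity)),
      ← ENNReal.ofReal_pow (Real.sqrt_nonneg _), Real.sq_sqrt hD0.le,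
      ← ENNReal.ofReal_mul hD0.le]
    exact ENNReal.ofReal_le_ofReal key
  calc _ ≤ ((ENNReal.ofReal (Real.sqrt D) * eLpNorm f 2 volume) ^ 2) ^ ((1 : ℝ) / 2) :=
        ENNReal.rpow_le_rpow main (by norm_num)
    _ = _ := by
      rw [← ENNReal.rpow_natCast, ← ENNReal.rpow_mul]
      norm_num
end

section
/- Let κ > 0 and let λ be a real number with λ < −κ/2. Then there exists a sequence (φ_n)_{n∈ℕ} of nonzero smooth compactly supported functions φ_n : ℝ → ℂ such that the support of φ_n is contained in [n, ∞) for every n, and ‖φ_n'' + (2·(−λ − κ/2)·x² − λ²)·φ_n‖ / ‖φ_n'‖ → 0 as n → ∞, where ‖·‖ denotes the L²(ℝ; ℂ) norm and (2·(−λ − κ/2)·x² − λ²)·φ_n denotes the function x ↦ (2(−λ−κ/2)x² − λ²)·φ_n(x). (This singular-sequence construction shows that every λ < −κ/2 belongs to the essential spectrum of the generator of the damped wave equation with damping a(x) = x² and potential q(x) = κx².) -/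
open MeasureTheory Filter

lemma aux_eLp (a b K : ℝ) (hab : a ≤ b) (hK : 0 ≤ K) :
    eLpNorm ((Set.Icc a b).indicator (fun _ : ℝ => K)) 2 volume
      = ENNReal.ofReal (K * Real.sqrt (b - a)) := by
  rw [eLpNorm_indicator_const measurableSet_Icc (by norm_num) (by norm_num)]
  rw [Real.volume_Icc, ENNReal.ofReal_mul hK, Real.enorm_eq_ofReal hK,
    ENNReal.ofReal_rpow_of_nonneg (by linarith) (by norm_num), Real.sqrt_eq_rpow]
  norm_num

lemma aux_comp (f : ℝ → ℝ) (d m x : ℝ) (h : HasDerivAt f d (x / m)) :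
    HasDerivAt (fun y => f (y / m)) (d / m) x := by
  have h1 : HasDerivAt (fun y : ℝ => y / m) (1 / m) x := (hasDerivAt_id' x).div_const m
  have h2 : HasDerivAt (fun y => f (y / m)) (d * (1 / m)) x :=
    HasDerivAt.comp (h₂ := f) (h := fun y : ℝ => y / m) x h h1
  rwa [mul_one_div] at h2

lemma aux_sq (α x : ℝ) : HasDerivAt (fun y : ℝ => α * y ^ 2 / 2) (α * x) x := by
  have h := ((hasDerivAt_pow 2 x).const_mul α).div_const 2
  have h2 : α * (((2 : ℕ) : ℝ) * x ^ (2 - 1)) / 2 = α * x := by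
    norm_num; ring
  rwa [h2] at h

theorem stmt19 (κ : ℝ) (hκ : 0 < κ) (lam : ℝ) (hlam : lam < -κ / 2) :
    ∃ φ : ℕ → ℝ → ℂ,
      (∀ n, ContDiff ℝ (⊤ : ℕ∞) (φ n)) ∧
      (∀ n, HasCompactSupport (φ n)) ∧
      (∀ n, φ n ≠ 0) ∧
      (∀ n : ℕ, tsupport (φ n) ⊆ Set.Ici (n : ℝ)) ∧
      Tendsto (fun n : ℕ =>
          (eLpNorm (fun x : ℝ => deriv (deriv (φ n)) x
              + ((2 * (-lam - κ / 2) * x ^ 2 - lam ^ 2 : ℝ) : ℂ) * φ n x) 2 volume).toReal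
            / (eLpNorm (deriv (φ n)) 2 volume).toReal)
        atTop (nhds 0) := by
  obtain ⟨α, hα, hαc⟩ : ∃ α : ℝ, 0 < α ∧ α ^ 2 = 2 * (-lam - κ / 2) := by
    have h : 0 < 2 * (-lam - κ / 2) := by linarith
    exact ⟨Real.sqrt _, Real.sqrt_pos.2 h, Real.sq_sqrt h.le⟩
  rw [← hαc]
  let B : ContDiffBump (2 : ℝ) := ⟨1/2, 1, by norm_num, by norm_num⟩
  obtain ⟨r, hr⟩ : ∃ r : ℝ → ℝ, r = B := ⟨_, rfl⟩
  have hrs : ContDiff ℝ (⊤ : ℕ∞) r := by rw [hr]; exact B.contDiff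
  have hrc : HasCompactSupport r := by rw [hr]; exact B.hasCompactSupport
  have hrt : tsupport r = Set.Icc 1 3 := by
    rw [hr, B.tsupport_eq, Real.closedBall_eq_Icc]; norm_num [B]
  have hr1 : ∀ y ∈ Set.Icc (3/2:ℝ) (5/2), r y = 1 := by
    intro y hy
    rw [hr]; apply B.one_of_mem_closedBall
    rw [Real.closedBall_eq_Icc]; norm_num [B]; exact hy
  have hr01 : ∀ y, |r y| ≤ 1 := by
    intro y
    rw [hr, abs_of_nonneg B.nonneg]; exact B.le_one
  clear_value B
  have hrs1 : ContDiff ℝ (⊤ : ℕ∞) (deriv r) := by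
    exact ((contDiff_infty_iff_deriv).1 hrs).2
  have hrs2 : ContDiff ℝ (⊤ : ℕ∞) (deriv (deriv r)) :=
    ((contDiff_infty_iff_deriv).1 hrs1).2
  have hd0 : ∀ y, HasDerivAt r (deriv r y) y := fun y =>
    (((contDiff_infty_iff_deriv).1 hrs).1 y).hasDerivAt
  have hd1 : ∀ y, HasDerivAt (deriv r) (deriv (deriv r) y) y := fun y =>
    (((contDiff_infty_iff_deriv).1 hrs1).1 y).hasDerivAt
  obtain ⟨C1, hC1⟩ := hrc.deriv.exists_bound_of_continuous hrs1.continuous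
  obtain ⟨C2, hC2⟩ := hrc.deriv.deriv.exists_bound_of_continuous hrs2.continuous
  have hz : ∀ y, y ∉ Set.Icc (1:ℝ) 3 → r y = 0 ∧ deriv r y = 0 ∧ deriv (deriv r) y = 0 := by
    intro y hy
    rw [← hrt] at hy
    have h1 : y ∉ tsupport (deriv r) := fun h => hy (tsupport_deriv_subset h)
    have h2 : y ∉ tsupport (deriv (deriv r)) := fun h => h1 (tsupport_deriv_subset h)
    exact ⟨image_eq_zero_of_notMem_tsupport hy, image_eq_zero_of_notMem_tsupport h1,
      image_eq_zero_of_notMem_tsupport h2⟩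
  let e : ℝ → ℂ := fun x => Complex.exp (((α * x ^ 2 / 2 : ℝ) : ℂ) * Complex.I)
  have hen : ∀ x, ‖e x‖ = 1 := fun x => Complex.norm_exp_ofReal_mul_I _
  have hes : ContDiff ℝ (⊤ : ℕ∞) e := by
    apply ContDiff.cexp
    apply ContDiff.mul _ contDiff_const
    apply Complex.ofRealCLM.contDiff.comp
    exact (contDiff_const.mul (contDiff_id.pow 2)).div_const 2
  have hed : ∀ x, HasDerivAt e (e x * (((α * x : ℝ) : ℂ) * Complex.I)) x := by
    intro x
    apply HasDerivAt.cexp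
    apply HasDerivAt.mul_const
    apply HasDerivAt.ofReal_comp
    exact aux_sq α x
  clear_value e
  let M : ℕ → ℝ := fun n => n + 1
  have hM1 : ∀ n, 1 ≤ M n := fun n => by simp [M]
  have hM0 : ∀ n, 0 < M n := fun n => by linarith [hM1 n]
  let φ : ℕ → ℝ → ℂ := fun n x => ((r (x / M n) : ℝ) : ℂ) * e x
  have hφs : ∀ n, ContDiff ℝ (⊤ : ℕ∞) (φ n) := by
    intro n
    apply ContDiff.mul _ hes
    apply Complex.ofRealCLM.contDiff.comp
    exact hrs.comp (by fun_prop)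
  have hmem : ∀ n x, x / M n ∈ Set.Icc (1:ℝ) 3 ↔ x ∈ Set.Icc (M n) (3 * M n) := by
    intro n x
    simp only [Set.mem_Icc, le_div_iff₀ (hM0 n), div_le_iff₀ (hM0 n), one_mul]
  have hsupp : ∀ n, tsupport (φ n) ⊆ Set.Icc (M n) (3 * M n) := by
    intro n
    apply closure_minimal _ isClosed_Icc
    intro x hx
    by_contra h
    rw [← hmem] at h
    apply hx
    simp [φ, (hz _ h).1]
  have hcs : ∀ n, HasCompactSupport (φ n) := fun n =>
    isCompact_Icc.of_isClosed_subset (isClosed_tsupport _) (hsupp n)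
  have hder1 : ∀ n x, HasDerivAt (φ n)
      (((deriv r (x / M n) / M n : ℝ) : ℂ) * e x +
        ((r (x / M n) : ℝ) : ℂ) * (e x * (((α * x : ℝ) : ℂ) * Complex.I))) x := by
    intro n x
    apply HasDerivAt.mul _ (hed x)
    apply HasDerivAt.ofReal_comp
    exact aux_comp _ _ _ _ (hd0 (x / M n))
  have hD1 : ∀ n, deriv (φ n) = fun x => (((deriv r (x / M n) / M n : ℝ) : ℂ) * e x +
        ((r (x / M n) : ℝ) : ℂ) * (e x * (((α * x : ℝ) : ℂ) * Complex.I))) :=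
    fun n => funext fun x => (hder1 n x).deriv
  have hder2 : ∀ n x, deriv (deriv (φ n)) x =
      ((((deriv (deriv r) (x / M n) / M n / M n : ℝ) : ℂ) * e x +
        ((deriv r (x / M n) / M n : ℝ) : ℂ) * (e x * (((α * x : ℝ) : ℂ) * Complex.I))) +
      (((deriv r (x / M n) / M n : ℝ) : ℂ) * (e x * (((α * x : ℝ) : ℂ) * Complex.I)) +
        ((r (x / M n) : ℝ) : ℂ) * ((e x * (((α * x : ℝ) : ℂ) * Complex.I)) *
            (((α * x : ℝ) : ℂ) * Complex.I) + e x * (((α : ℝ) : ℂ) * Complex.I)))) := by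
    intro n x
    rw [hD1]
    apply HasDerivAt.deriv
    apply HasDerivAt.add
    · apply HasDerivAt.mul _ (hed x)
      apply HasDerivAt.ofReal_comp
      apply HasDerivAt.div_const
      exact aux_comp _ _ _ _ (hd1 (x / M n))
    · apply HasDerivAt.mul
      · apply HasDerivAt.ofReal_comp
        exact aux_comp _ _ _ _ (hd0 (x / M n))
      · apply HasDerivAt.mul (hed x)
        apply HasDerivAt.mul_const
        apply HasDerivAt.ofReal_comp
        simpa using (hasDerivAt_id x).const_mul α
  have hC1n : 0 ≤ C1 := (norm_nonneg _).trans (hC1 0)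
  have hC2n : 0 ≤ C2 := (norm_nonneg _).trans (hC2 0)
  let K : ℝ := C2 + 6 * α * C1 + α + lam ^ 2
  have hK : 0 ≤ K := by positivity
  have hnum : ∀ n, eLpNorm (fun x : ℝ => deriv (deriv (φ n)) x
              + ((α ^ 2 * x ^ 2 - lam ^ 2 : ℝ) : ℂ) * φ n x) 2 volume ≤
      ENNReal.ofReal (K * Real.sqrt (3 * M n - M n)) := by
    intro n
    have hm := hM0 n
    have hm1 := hM1 n
    rw [← aux_eLp _ _ _ (by linarith) hK]
    apply eLpNorm_mono
    intro x
    have key : deriv (deriv (φ n)) x + ((α ^ 2 * x ^ 2 - lam ^ 2 : ℝ) : ℂ) * φ n x =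
      (((deriv (deriv r) (x / M n) / M n / M n - lam ^ 2 * r (x / M n) : ℝ) : ℂ) +
       ((2 * α * (deriv r (x / M n) * (x / M n)) + α * r (x / M n) : ℝ) : ℂ) * Complex.I) * e x := by
      rw [hder2]
      simp only [φ]
      push_cast
      linear_combination (((r (x / M n) : ℝ) : ℂ) * e x * α ^ 2 * x ^ 2) * Complex.I_sq
    rw [key, norm_mul, hen, mul_one]
    by_cases hx : x ∈ Set.Icc (M n) (3 * M n)
    · rw [Set.indicator_of_mem hx, Real.norm_of_nonneg hK]
      rw [← hmem] at hx
      refine (norm_add_le _ _).trans ?_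
      rw [norm_mul, Complex.norm_I, mul_one, Complex.norm_real, Complex.norm_real]
      have h0 := hr01 (x / M n)
      have h1 := hC1 (x / M n)
      have h2 := hC2 (x / M n)
      simp only [Real.norm_eq_abs] at *
      have e1 : |deriv (deriv r) (x / M n) / M n / M n| ≤ C2 := by
        rw [abs_div, abs_div, abs_of_pos hm]
        exact (div_le_self (by positivity) hm1).trans ((div_le_self (by positivity) hm1).trans h2)
      have e2 : |lam ^ 2 * r (x / M n)| ≤ lam ^ 2 := by
        rw [abs_mul, abs_of_nonneg (sq_nonneg _)]
        exact mul_le_of_le_one_right (sq_nonneg _) h0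
      have e3 : |2 * α * (deriv r (x / M n) * (x / M n))| ≤ 2 * α * (C1 * 3) := by
        rw [abs_mul, abs_of_pos (by positivity : 0 < 2 * α), abs_mul]
        have : |x / M n| ≤ 3 := abs_le.2 ⟨by linarith [hx.1], hx.2⟩
        gcongr
      have e4 : |α * r (x / M n)| ≤ α := by
        rw [abs_mul, abs_of_pos hα]
        exact mul_le_of_le_one_right hα.le h0
      have a1 := abs_sub (deriv (deriv r) (x / M n) / M n / M n) (lam ^ 2 * r (x / M n))
      have a2 := abs_add_le (2 * α * (deriv r (x / M n) * (x / M n))) (α * r (x / M n))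
      simp only [K]
      linarith
    · rw [← hmem] at hx
      obtain ⟨h0, h1, h2⟩ := hz _ hx
      rw [h0, h1, h2]
      simp
  have hden : ∀ n, ENNReal.ofReal (α * M n * Real.sqrt (5/2 * M n - 3/2 * M n)) ≤
      eLpNorm (deriv (φ n)) 2 volume := by
    intro n
    have hm := hM0 n
    rw [← aux_eLp _ _ _ (by linarith) (by positivity)]
    apply eLpNorm_mono
    intro x
    by_cases hx : x ∈ Set.Icc (3/2 * M n) (5/2 * M n)
    · rw [Set.indicator_of_mem hx, Real.norm_of_nonneg (by positivity), hD1]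
      have hr' : r (x / M n) = 1 := by
        apply hr1
        simpa only [Set.mem_Icc, le_div_iff₀ hm, div_le_iff₀ hm] using hx
      have : ((deriv r (x / M n) / M n : ℝ) : ℂ) * e x +
        ((r (x / M n) : ℝ) : ℂ) * (e x * (((α * x : ℝ) : ℂ) * Complex.I)) =
        (((deriv r (x / M n) / M n : ℝ) : ℂ) + ((α * x : ℝ) : ℂ) * Complex.I) * e x := by
        rw [hr']; push_cast; ring
      simp only []
      rw [this, norm_mul, hen, mul_one]
      refine le_trans ?_ (Complex.abs_im_le_norm _)
      rw [Complex.add_im, Complex.im_ofReal_mul, Complex.ofReal_im, Complex.I_im]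
      refine le_trans ?_ (le_abs_self _)
      have : M n ≤ x := by linarith [hx.1]
      nlinarith
    · rw [Set.indicator_of_notMem hx]; simp
  have hfin : ∀ n, eLpNorm (deriv (φ n)) 2 volume ≠ ⊤ := by
    intro n
    have hc : Continuous (deriv (φ n)) := ((contDiff_infty_iff_deriv).1 (hφs n)).2.continuous
    exact (hc.memLp_of_hasCompactSupport (hcs n).deriv).2.ne
  refine ⟨φ, hφs, hcs, ?_, ?_, ?_⟩
  · intro n h
    have := congrFun h (2 * M n)
    have h2 : r (2 * M n / M n) = 1 := by
      rw [mul_div_cancel_right₀ _ (hM0 n).ne']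
      exact hr1 _ (by norm_num)
    simp only [φ, h2, Pi.zero_apply] at this
    have h3 := hen (2 * M n)
    simp at this
    rw [this] at h3
    simp at h3
  · intro n x hx
    have := (hsupp n hx).1
    simp only [M] at this
    simp only [Set.mem_Ici]; linarith
  · have hlim : Tendsto (fun n : ℕ => (K * Real.sqrt 2 / α) * (1 / ((n : ℝ) + 1))) atTop (nhds 0) := by
      simpa using tendsto_one_div_add_atTop_nhds_zero_nat.const_mul (K * Real.sqrt 2 / α)
    refine squeeze_zero (fun n => by positivity) (fun n => ?_) hlim
    have hm := hM0 n
    have h1 := ENNReal.toReal_mono ENNReal.ofReal_ne_top (hnum n)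
    have h2 := ENNReal.toReal_mono (hfin n) (hden n)
    rw [ENNReal.toReal_ofReal (by positivity)] at h1 h2
    have s1 : 3 * M n - M n = 2 * M n := by ring
    have s2 : 5/2 * M n - 3/2 * M n = M n := by ring
    rw [s1, Real.sqrt_mul (by norm_num)] at h1
    rw [s2] at h2
    have hsq : 0 < Real.sqrt (M n) := Real.sqrt_pos.2 hm
    calc _ ≤ (K * (Real.sqrt 2 * Real.sqrt (M n))) / (α * M n * Real.sqrt (M n)) :=
          div_le_div₀ (by positivity) h1 (by positivity) h2
      _ = (K * Real.sqrt 2 / α) * (1 / M n) := by field_simp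
end
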